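/- Let n ≥ 4 and let u ∈ A_n satisfy δ_n(u) = 0. Then there exists w ∈ A_{n+1} such that δ_{n+1}(w) = u (the complex (A_•, δ_•) is exact at A_n for all n ≥ 4). -/

import Mathlib

open Finset

/-- A list `[m_1, …, m_n]` of natural numbers is an Anick chain if it is nonempty,
`m_j ≥ 2` for all `1 ≤ j ≤ n-2`, and (when `n ≥ 2`) either `m_{n-1} ≥ 2` or
`(m_{n-1}, m_n) = (1, 0)`. -/
def AnickChain (l : List ℕ) : Prop :=
  l ≠ [] ∧ (∀ j, j + 2 < l.length → 2 ≤ l.getD j 0) ∧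
    (2 ≤ l.length →
      2 ≤ l.getD (l.length - 2) 0 ∨
        (l.getD (l.length - 2) 0 = 1 ∧ l.getD (l.length - 1) 0 = 0))

/-- The ℚ-vector space with basis the set of all Anick chains (of all lengths);
its length-homogeneous components are the spaces `A_n`. -/
abbrev AnickSpace : Type := {l : List ℕ // AnickChain l} →₀ ℚ

open Classical in
/-- The basis element `[m_1|…|m_n]` attached to a list; by convention it is `0`
if the list is not an Anick chain. -/
noncomputable def br (l : List ℕ) : AnickSpace :=
  if h : AnickChain l then Finsupp.single ⟨l, h⟩ 1 else 0

/-- The `j`-th entry of a list, `1`-based (with default value 0). -/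
def ent (l : List ℕ) (j : ℕ) : ℕ := l.getD (j - 1) 0

/-- Replace the pair of entries at (1-based) positions `j, j+1` by the single entry `c`. -/
def mergeAt (l : List ℕ) (j c : ℕ) : List ℕ := l.take (j - 1) ++ c :: l.drop (j + 1)

/-- Decrease the (1-based) `t`-th entry by one. -/
def decAt (l : List ℕ) (t : ℕ) : List ℕ := l.set (t - 1) (ent l t - 1)

open Classical in
/-- The value of the Anick differential on the basis chain `[i_1|…|i_{n+1}]`. -/
noncomputable def deltaFun (l : List ℕ) : AnickSpace :=
  let n := l.length - 1
  let i : ℕ → ℚ := fun j => (ent l j : ℚ)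
  if 2 ≤ ent l n then
    (∑ j ∈ Icc 1 n, ((-1 : ℚ) ^ j * (i j * (i j - 1) / (i j + i (j + 1) - 1))) •
        br (mergeAt l j (ent l j + ent l (j + 1) - 1)))
    + (∑ j ∈ Icc 2 n, ∑ t ∈ Icc 1 (j - 1),
        ((-1 : ℚ) ^ j * (i t * (i j - 1) * (i (j + 1) - 1) / (i j + i (j + 1) - 1))) •
          br (mergeAt (decAt l t) j (ent l j + ent l (j + 1))))
    + (∑ j ∈ Icc 2 n, ∑ t ∈ Icc 1 (j - 1),
        ((-1 : ℚ) ^ j * (i j * i (j + 1) * (i t - 1) / (i j + i (j + 1) - 1))) •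
          br (mergeAt l j (ent l j + ent l (j + 1) - 1)))
  else if ent l n = 1 ∧ ent l (n + 1) = 0 then
    (∑ j ∈ Icc 1 (n - 2), ((-1 : ℚ) ^ j * (i j * (i j - 1) / (i j + i (j + 1) - 1))) •
        br (mergeAt l j (ent l j + ent l (j + 1) - 1)))
    + (∑ j ∈ Icc 2 (n - 2), ∑ t ∈ Icc 1 (j - 1),
        ((-1 : ℚ) ^ j * (i t * (i j - 1) * (i (j + 1) - 1) / (i j + i (j + 1) - 1))) •
          br (mergeAt (decAt l t) j (ent l j + ent l (j + 1))))
    + (∑ j ∈ Icc 2 (n - 2), ∑ t ∈ Icc 1 (j - 1),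
        ((-1 : ℚ) ^ j * (i j * i (j + 1) * (i t - 1) / (i j + i (j + 1) - 1))) •
          br (mergeAt l j (ent l j + ent l (j + 1) - 1)))
    + (∑ j ∈ Icc 1 (n - 1), ((-1 : ℚ) ^ n * i j) • br ((decAt l j).dropLast))
    + (∑ j ∈ Icc 1 (n - 1), ((-1 : ℚ) ^ (n - 1) * (i j - 1)) • br (l.take (n - 1) ++ [0]))
    + ((-1 : ℚ) ^ n • br (l.take (n - 1) ++ [0]))
  else 0

/-- The Anick differential `δ` (the direct sum of all the maps `δ_n`; on the
length-one component it vanishes, i.e. `δ_1 = 0`). -/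
noncomputable def anickDelta : AnickSpace →ₗ[ℚ] AnickSpace :=
  Finsupp.linearCombination ℚ (fun c => deltaFun c.1)

/-- The value of `∂̃` on a basis chain. -/
noncomputable def dtilFun (l : List ℕ) : AnickSpace :=
  ∑ j ∈ Finset.range l.length, (l.getD j 0 : ℚ) • br (l.set j (l.getD j 0 - 1))

/-- The derivation `∂̃` on the Anick complex. -/
noncomputable def dtil : AnickSpace →ₗ[ℚ] AnickSpace :=
  Finsupp.linearCombination ℚ (fun c => dtilFun c.1)

/-- `A_n`: the span of the Anick chains of length `n`. -/
noncomputable def A (n : ℕ) : Submodule ℚ AnickSpace :=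
  Finsupp.supported ℚ ℚ {c | c.1.length = n}

/-- `A_{n,k}`: the span of the Anick chains of length `n` whose last entry is `≥ k`. -/
noncomputable def Ak (n k : ℕ) : Submodule ℚ AnickSpace :=
  Finsupp.supported ℚ ℚ {c | c.1.length = n ∧ k ≤ c.1.getD (n - 1) 0}

/-- `A_n^{(d)}`: the span of the Anick chains of length `n` and degree `d`. -/
noncomputable def Adeg (n d : ℕ) : Submodule ℚ AnickSpace :=
  Finsupp.supported ℚ ℚ {c | c.1.length = n ∧ c.1.sum = d}

/-- `A_n^{(d)∘}`: the span of the regular Anick chains (all entries `≥ 2`) of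
length `n` and degree `d`. -/
noncomputable def Areg (n d : ℕ) : Submodule ℚ AnickSpace :=
  Finsupp.supported ℚ ℚ {c | c.1.length = n ∧ c.1.sum = d ∧ ∀ j < n, 2 ≤ c.1.getD j 0}

/-- `K_n = ker ∂̃_n ⊆ A_n`. -/
noncomputable def K (n : ℕ) : Submodule ℚ AnickSpace := A n ⊓ LinearMap.ker dtil

/-- `K_n^{(d)} = K_n ∩ A_n^{(d)}`. -/
noncomputable def Kdeg (n d : ℕ) : Submodule ℚ AnickSpace := K n ⊓ Adeg n d

open Classical in
/-- The component map `a ↦ a_i`: keep only the chains whose last entry is `i`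
and delete that last entry. -/
noncomputable def component (i : ℕ) : AnickSpace →ₗ[ℚ] AnickSpace :=
  Finsupp.linearCombination ℚ
    (fun c => if c.1.getLast? = some i then br c.1.dropLast else 0)

/-- The elements `e_1 = [1|0]` and `e_d = Σ_{s=0}^{d-2} (-1)^s C(d,s) [d-s|s]` for `d ≥ 3`. -/
noncomputable def eElt (d : ℕ) : AnickSpace :=
  if d = 1 then br [1, 0]
  else ∑ s ∈ Finset.range (d - 1), ((-1 : ℚ) ^ s * (d.choose s : ℚ)) • br [d - s, s]

/-- The contracting homotopy (up to the scalar `-2`)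
`[b|m_2|…|m_n] ↦ b [2|b-1|m_2|…|m_n]` of the Anick complex. -/
noncomputable def splitFirst : AnickSpace →ₗ[ℚ] AnickSpace :=
  Finsupp.linearCombination ℚ
    (fun c => (c.1.headD 0 : ℚ) • br (2 :: (c.1.headD 0 - 1) :: c.1.tail))

lemma br_of_not_anickChain {l : List ℕ} (h : ¬ AnickChain l) : br l = 0 := by
  simp [br, h]

lemma anickChain_cons {b : ℕ} {x : List ℕ} (hx : 2 ≤ x.length) :
    AnickChain (b :: x) ↔ 2 ≤ b ∧ AnickChain x := by
  obtain ⟨c, d, y, rfl⟩ : ∃ c d y, x = c :: d :: y := by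
    match x, hx with
    | c :: d :: y, _ => exact ⟨c, d, y, rfl⟩
  simp only [AnickChain, List.length_cons]
  constructor
  · rintro ⟨-, h1, h2⟩
    refine ⟨by simpa using h1 0 (by omega), by simp, fun j hj => ?_, fun _ => ?_⟩
    · simpa using h1 (j + 1) (by omega)
    · simpa using h2 (by omega)
  · rintro ⟨hb, -, h1, h2⟩
    refine ⟨by simp, fun j hj => ?_, fun _ => ?_⟩
    · cases j with
      | zero => simpa using hb
      | succ j => simpa using h1 j (by omega)
    · simpa using h2 (by omega)

lemma br_cons_of_lt_two {b : ℕ} {x : List ℕ} (hb : b < 2) (hx : 2 ≤ x.length) :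
    br (b :: x) = 0 :=
  br_of_not_anickChain fun h => by
    have := ((anickChain_cons hx).1 h).1
    omega

lemma br_cons_cons_of_lt_two {a b : ℕ} {x : List ℕ} (hb : b < 2) (hx : 2 ≤ x.length) :
    br (a :: b :: x) = 0 :=
  br_of_not_anickChain fun h => by
    have h1 := ((anickChain_cons (by simp; omega)).1 h).2
    have := ((anickChain_cons hx).1 h1).1
    omega

lemma splitFirst_br_cons {b : ℕ} {x : List ℕ} (hx : 2 ≤ x.length) :
    splitFirst (br (b :: x)) = (b : ℚ) • br (2 :: (b - 1) :: x) := by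
  by_cases h : AnickChain (b :: x)
  · rw [br, dif_pos h]
    simp [splitFirst]
  · rw [br_of_not_anickChain h, map_zero]
    by_cases hb : 2 ≤ b
    · have hx' : ¬ AnickChain x := fun h' => h ((anickChain_cons hx).2 ⟨hb, h'⟩)
      rw [br_of_not_anickChain, smul_zero]
      intro h2
      exact hx' ((anickChain_cons hx).1 ((anickChain_cons (by simp; omega)).1 h2).2).2
    · rw [br_cons_cons_of_lt_two (by omega) hx, smul_zero]

lemma ent_cons_one (b : ℕ) (x : List ℕ) : ent (b :: x) 1 = b := rfl

lemma ent_cons_add_two (b : ℕ) (x : List ℕ) (k : ℕ) : ent (b :: x) (k + 2) = ent x (k + 1) := rfl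

lemma decAt_cons_one (b : ℕ) (x : List ℕ) : decAt (b :: x) 1 = (b - 1) :: x := rfl

lemma decAt_cons_add_two (b : ℕ) (x : List ℕ) (k : ℕ) :
    decAt (b :: x) (k + 2) = b :: decAt x (k + 1) := rfl

lemma mergeAt_cons_cons_one (b c : ℕ) (y : List ℕ) (m : ℕ) :
    mergeAt (b :: c :: y) 1 m = m :: y := rfl

lemma two_le_length_mergeAt {x : List ℕ} (hx : 3 ≤ x.length) (k m : ℕ) :
    2 ≤ (mergeAt x k m).length := by
  simp only [mergeAt, List.length_append, List.length_take, List.length_cons, List.length_drop]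
  omega

lemma length_decAt (l : List ℕ) (t : ℕ) : (decAt l t).length = l.length := by
  simp [decAt]

lemma sum_Icc_one_eq_sum_range {M : Type*} [AddCommMonoid M] (f : ℕ → M) (n : ℕ) :
    ∑ j ∈ Icc 1 n, f j = ∑ k ∈ range n, f (k + 1) := by
  rw [range_eq_Ico, sum_Ico_add' f 0 n 1]
  rfl

lemma sum_Icc_two_eq_sum_range {M : Type*} [AddCommMonoid M] (f : ℕ → M) (n : ℕ) :
    ∑ j ∈ Icc 2 (n + 1), f j = ∑ k ∈ range n, f (k + 2) := by
  rw [range_eq_Ico, sum_Ico_add' f 0 n 2]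
  rfl

/-- The part of the differential of `l` that merges the neighbours at positions `j, j + 1`
for `j ≤ J`. -/
noncomputable def mergeSum (l : List ℕ) (J : ℕ) : AnickSpace :=
  let i : ℕ → ℚ := fun j => (ent l j : ℚ)
  (∑ j ∈ Icc 1 J, ((-1 : ℚ) ^ j * (i j * (i j - 1) / (i j + i (j + 1) - 1))) •
      br (mergeAt l j (ent l j + ent l (j + 1) - 1)))
  + (∑ j ∈ Icc 2 J, ∑ t ∈ Icc 1 (j - 1),
      ((-1 : ℚ) ^ j * (i t * (i j - 1) * (i (j + 1) - 1) / (i j + i (j + 1) - 1))) •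
        br (mergeAt (decAt l t) j (ent l j + ent l (j + 1))))
  + (∑ j ∈ Icc 2 J, ∑ t ∈ Icc 1 (j - 1),
      ((-1 : ℚ) ^ j * (i j * i (j + 1) * (i t - 1) / (i j + i (j + 1) - 1))) •
        br (mergeAt l j (ent l j + ent l (j + 1) - 1)))

/-- The part of the differential of `[i_1|…|i_{n-1}|1|0]` that deletes an entry of the tail. -/
noncomputable def tailSum (l : List ℕ) (n : ℕ) : AnickSpace :=
  let i : ℕ → ℚ := fun j => (ent l j : ℚ)
  (∑ j ∈ Icc 1 (n - 1), ((-1 : ℚ) ^ n * i j) • br ((decAt l j).dropLast))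
    + (∑ j ∈ Icc 1 (n - 1), ((-1 : ℚ) ^ (n - 1) * (i j - 1)) • br (l.take (n - 1) ++ [0]))
    + ((-1 : ℚ) ^ n • br (l.take (n - 1) ++ [0]))

lemma deltaFun_of_two_le {l : List ℕ} {n : ℕ} (hn : l.length = n + 1) (h : 2 ≤ ent l n) :
    deltaFun l = mergeSum l n := by
  obtain rfl : n = l.length - 1 := by omega
  simp only [deltaFun, mergeSum, if_pos h]

lemma deltaFun_of_one_zero {l : List ℕ} {n : ℕ} (hn : l.length = n + 1) (h : ent l n = 1)
    (h' : ent l (n + 1) = 0) : deltaFun l = mergeSum l (n - 2) + tailSum l n := by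
  obtain rfl : n = l.length - 1 := by omega
  have h2 : ¬ 2 ≤ ent l (l.length - 1) := by omega
  simp only [deltaFun, mergeSum, tailSum, if_neg h2, if_pos (And.intro h h'), add_assoc]

/-- The part of the differential of `l` that merges the neighbours at positions
`k + 2, k + 3`. -/
noncomputable def mergeTerm (l : List ℕ) (k : ℕ) : AnickSpace :=
  let i : ℕ → ℚ := fun j => (ent l j : ℚ)
  ((-1 : ℚ) ^ (k + 2) * (i (k + 2) * (i (k + 2) - 1) / (i (k + 2) + i (k + 3) - 1))) •
      br (mergeAt l (k + 2) (ent l (k + 2) + ent l (k + 3) - 1))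
  + (∑ t ∈ range (k + 1),
      ((-1 : ℚ) ^ (k + 2) * (i (t + 1) * (i (k + 2) - 1) * (i (k + 3) - 1) /
        (i (k + 2) + i (k + 3) - 1))) •
        br (mergeAt (decAt l (t + 1)) (k + 2) (ent l (k + 2) + ent l (k + 3))))
  + (∑ t ∈ range (k + 1),
      ((-1 : ℚ) ^ (k + 2) * (i (k + 2) * i (k + 3) * (i (t + 1) - 1) /
        (i (k + 2) + i (k + 3) - 1))) •
        br (mergeAt l (k + 2) (ent l (k + 2) + ent l (k + 3) - 1)))

lemma mergeSum_succ (b c : ℕ) (y : List ℕ) (J : ℕ) :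
    mergeSum (b :: c :: y) (J + 1) =
      (-((b : ℚ) * (b - 1) / (b + c - 1))) • br ((b + c - 1) :: y)
        + ∑ k ∈ range J, mergeTerm (b :: c :: y) k := by
  simp only [mergeSum, sum_Icc_two_eq_sum_range, sum_Icc_one_eq_sum_range, mergeTerm,
    sum_add_distrib, Nat.add_succ_sub_one]
  rw [sum_range_succ' _ J]
  simp only [ent_cons_add_two, ent_cons_one, zero_add, mergeAt_cons_cons_one,
    show ∀ k, k + 1 + 1 = k + 2 from fun _ => rfl, show ent (b :: c :: y) 2 = c from rfl, pow_one,
    neg_one_mul]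
  abel

lemma mergeTerm_cons (b : ℕ) (x : List ℕ) (k : ℕ) :
    mergeTerm (b :: x) k =
      let i : ℕ → ℚ := fun j => (ent x j : ℚ)
      let p := i (k + 1)
      let q := i (k + 2)
      ((-1 : ℚ) ^ (k + 2) * (p * (p - 1) / (p + q - 1))) •
          br (b :: mergeAt x (k + 1) (ent x (k + 1) + ent x (k + 2) - 1))
      + (∑ t ∈ range k, ((-1 : ℚ) ^ (k + 2) * (i (t + 1) * (p - 1) * (q - 1) / (p + q - 1))) •
            br (b :: mergeAt (decAt x (t + 1)) (k + 1) (ent x (k + 1) + ent x (k + 2)))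
        + ((-1 : ℚ) ^ (k + 2) * (b * (p - 1) * (q - 1) / (p + q - 1))) •
            br ((b - 1) :: mergeAt x (k + 1) (ent x (k + 1) + ent x (k + 2))))
      + (∑ t ∈ range k, ((-1 : ℚ) ^ (k + 2) * (p * q * (i (t + 1) - 1) / (p + q - 1))) •
            br (b :: mergeAt x (k + 1) (ent x (k + 1) + ent x (k + 2) - 1))
        + ((-1 : ℚ) ^ (k + 2) * (p * q * (b - 1) / (p + q - 1))) •
            br (b :: mergeAt x (k + 1) (ent x (k + 1) + ent x (k + 2) - 1))) := by
  rw [mergeTerm, sum_range_succ', sum_range_succ']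
  rfl

lemma mergeTerm_cons_cons (a b : ℕ) (x : List ℕ) (k : ℕ) :
    mergeTerm (a :: b :: x) (k + 1) =
      let i : ℕ → ℚ := fun j => (ent x j : ℚ)
      let p := i (k + 1)
      let q := i (k + 2)
      ((-1 : ℚ) ^ (k + 3) * (p * (p - 1) / (p + q - 1))) •
          br (a :: b :: mergeAt x (k + 1) (ent x (k + 1) + ent x (k + 2) - 1))
      + (∑ t ∈ range k, ((-1 : ℚ) ^ (k + 3) * (i (t + 1) * (p - 1) * (q - 1) / (p + q - 1))) •
            br (a :: b :: mergeAt (decAt x (t + 1)) (k + 1) (ent x (k + 1) + ent x (k + 2)))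
        + ((-1 : ℚ) ^ (k + 3) * (b * (p - 1) * (q - 1) / (p + q - 1))) •
            br (a :: (b - 1) :: mergeAt x (k + 1) (ent x (k + 1) + ent x (k + 2)))
        + ((-1 : ℚ) ^ (k + 3) * (a * (p - 1) * (q - 1) / (p + q - 1))) •
            br ((a - 1) :: b :: mergeAt x (k + 1) (ent x (k + 1) + ent x (k + 2))))
      + (∑ t ∈ range k, ((-1 : ℚ) ^ (k + 3) * (p * q * (i (t + 1) - 1) / (p + q - 1))) •
            br (a :: b :: mergeAt x (k + 1) (ent x (k + 1) + ent x (k + 2) - 1))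
        + ((-1 : ℚ) ^ (k + 3) * (p * q * (b - 1) / (p + q - 1))) •
            br (a :: b :: mergeAt x (k + 1) (ent x (k + 1) + ent x (k + 2) - 1))
        + ((-1 : ℚ) ^ (k + 3) * (p * q * (a - 1) / (p + q - 1))) •
            br (a :: b :: mergeAt x (k + 1) (ent x (k + 1) + ent x (k + 2) - 1))) := by
  rw [mergeTerm_cons]
  dsimp only
  rw [sum_range_succ', sum_range_succ']
  rfl

lemma splitFirst_mergeTerm (b : ℕ) {x : List ℕ} (hb : 2 ≤ b) (hx : 3 ≤ x.length) (k : ℕ) :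
    (b : ℚ) • mergeTerm (2 :: (b - 1) :: x) (k + 1) + splitFirst (mergeTerm (b :: x) k) = 0 := by
  have hm : ∀ k m, 2 ≤ (mergeAt x k m).length := two_le_length_mergeAt hx
  have hm' : ∀ t k m, 2 ≤ (mergeAt (decAt x t) k m).length := fun t =>
    two_le_length_mergeAt (by rwa [length_decAt])
  have hb1 : ((b - 1 : ℕ) : ℚ) = b - 1 := by push_cast [Nat.cast_sub (by omega : 1 ≤ b)]; ring
  have h1 : ∀ k m, br ((2 - 1) :: (b - 1) :: mergeAt x k m) = 0 := fun k m =>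
    br_cons_of_lt_two (by norm_num) (by simpa using (hm k m).trans (Nat.le_succ _))
  rw [mergeTerm_cons_cons, mergeTerm_cons]
  have hs : ∀ (e f : ℕ → ℚ) (v : ℕ → AnickSpace), (∀ t, e t = - f t) →
      ∑ t ∈ range k, (b : ℚ) • e t • v t = - ∑ t ∈ range k, f t • (b : ℚ) • v t := by
    intro e f v hef
    rw [← sum_neg_distrib]
    exact sum_congr rfl fun t _ => by rw [hef]; module
  have hp : (-1 : ℚ) ^ (k + 3) = - (-1 : ℚ) ^ (k + 2) := by ring
  simp only [map_add, map_smul, map_sum, splitFirst_br_cons (hm _ _),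
    splitFirst_br_cons (hm' _ _ _), h1, hb1, smul_add, smul_sum, Nat.cast_ofNat, hp, smul_zero,
    add_zero]
  rw [hs _ _ _ fun t => neg_mul _ _, hs _ _ _ fun t => neg_mul _ _]
  module

lemma mergeTerm_zero (a b c : ℕ) (y : List ℕ) :
    mergeTerm (a :: b :: c :: y) 0 =
      ((b : ℚ) * (b - 1) / (b + c - 1)) • br (a :: (b + c - 1) :: y)
        + ((a : ℚ) * (b - 1) * (c - 1) / (b + c - 1)) • br ((a - 1) :: (b + c) :: y)
        + ((b : ℚ) * c * (a - 1) / (b + c - 1)) • br (a :: (b + c - 1) :: y) := by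
  rw [mergeTerm_cons]
  simp [ent, mergeAt]

lemma splitFirst_mergeSum {b c : ℕ} {y : List ℕ} (hb : 2 ≤ b) (hc : 2 ≤ c) (hy : 2 ≤ y.length)
    (J : ℕ) :
    (b : ℚ) • mergeSum (2 :: (b - 1) :: c :: y) (J + 2)
      + splitFirst (mergeSum (b :: c :: y) (J + 1)) = (-2 : ℚ) • br (b :: c :: y) := by
  have hb1 : ((b - 1 : ℕ) : ℚ) = b - 1 := by push_cast [Nat.cast_sub (by omega : 1 ≤ b)]; ring
  have hbc : ((b + c - 1 : ℕ) : ℚ) = b + c - 1 := by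
    push_cast [Nat.cast_sub (by omega : 1 ≤ b + c)]; ring
  have hb2 : (2 : ℚ) ≤ b := by exact_mod_cast hb
  have hc2 : (2 : ℚ) ≤ c := by exact_mod_cast hc
  have hb0 : (b : ℚ) ≠ 0 := by positivity
  have hbc1 : (b : ℚ) + c - 1 ≠ 0 := by linarith
  have hbc2 : (b : ℚ) - 1 + c - 1 ≠ 0 := by linarith
  have h := sum_congr rfl fun k (_ : k ∈ range J) =>
    splitFirst_mergeTerm b (x := c :: y) hb (by simpa using hy) k
  rw [sum_add_distrib, ← smul_sum, ← map_sum, sum_const_zero] at h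
  have h0 : br ((2 - 1) :: (b - 1 + c) :: y) = 0 :=
    br_cons_of_lt_two (by norm_num) (by simp; omega)
  rw [mergeSum_succ, mergeSum_succ, sum_range_succ', mergeTerm_zero, h0, map_add, map_smul,
    splitFirst_br_cons hy, hb1, hbc, show 2 + (b - 1) - 1 = b by omega,
    show b - 1 + c - 1 = b + c - 1 - 1 by omega, eq_neg_of_add_eq_zero_right h, Nat.cast_ofNat,
    show (2 : ℚ) + (b - 1) - 1 = b by ring]
  match_scalars
  · field_simp
    ring
  · ring
  · field_simp
    ring

lemma tailSum_cons {b : ℕ} {x : List ℕ} (hx : x ≠ []) (n : ℕ) :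
    tailSum (b :: x) (n + 2) =
      (∑ t ∈ range n, ((-1 : ℚ) ^ n * ent x (t + 1)) • br (b :: (decAt x (t + 1)).dropLast)
        + ((-1 : ℚ) ^ n * b) • br ((b - 1) :: x.dropLast))
      + (∑ t ∈ range n, ((-1 : ℚ) ^ (n + 1) * (ent x (t + 1) - 1)) • br (b :: (x.take n ++ [0]))
        + ((-1 : ℚ) ^ (n + 1) * (b - 1)) • br (b :: (x.take n ++ [0])))
      + (-1 : ℚ) ^ n • br (b :: (x.take n ++ [0])) := by
  have hd : ∀ t, decAt x t ≠ [] := fun t => by simpa [decAt] using hx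
  simp only [tailSum, sum_Icc_one_eq_sum_range, Nat.add_succ_sub_one]
  rw [sum_range_succ', sum_range_succ']
  simp only [ent_cons_add_two, decAt_cons_add_two, ent_cons_one, decAt_cons_one, zero_add,
    List.dropLast_cons_of_ne_nil hx, List.dropLast_cons_of_ne_nil (hd _), List.take_succ_cons,
    List.cons_append, pow_succ, mul_neg_one, neg_neg]

lemma tailSum_cons_cons {a b : ℕ} {x : List ℕ} (hx : x ≠ []) (n : ℕ) :
    tailSum (a :: b :: x) (n + 3) =
      (∑ t ∈ range n, ((-1 : ℚ) ^ (n + 1) * ent x (t + 1)) •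
          br (a :: b :: (decAt x (t + 1)).dropLast)
        + ((-1 : ℚ) ^ (n + 1) * b) • br (a :: (b - 1) :: x.dropLast)
        + ((-1 : ℚ) ^ (n + 1) * a) • br ((a - 1) :: b :: x.dropLast))
      + (∑ t ∈ range n, ((-1 : ℚ) ^ n * (ent x (t + 1) - 1)) •
          br (a :: b :: (x.take n ++ [0]))
        + ((-1 : ℚ) ^ n * (b - 1)) • br (a :: b :: (x.take n ++ [0]))
        + ((-1 : ℚ) ^ n * (a - 1)) • br (a :: b :: (x.take n ++ [0])))
      + (-1 : ℚ) ^ (n + 1) • br (a :: b :: (x.take n ++ [0])) := by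
  have hd : ∀ t, decAt x t ≠ [] := fun t => by simpa [decAt] using hx
  rw [tailSum_cons (List.cons_ne_nil b x) (n + 1), sum_range_succ', sum_range_succ']
  simp only [ent_cons_add_two, decAt_cons_add_two, ent_cons_one, decAt_cons_one, zero_add,
    List.dropLast_cons_of_ne_nil hx, List.dropLast_cons_of_ne_nil (hd _), List.take_succ_cons,
    List.cons_append, pow_succ, mul_neg_one, neg_neg]

lemma splitFirst_tailSum {b : ℕ} {x : List ℕ} (hb : 2 ≤ b) (hx : 3 ≤ x.length) (n : ℕ) :
    (b : ℚ) • tailSum (2 :: (b - 1) :: x) (n + 4) + splitFirst (tailSum (b :: x) (n + 3)) = 0 := by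
  have hb1 : ((b - 1 : ℕ) : ℚ) = b - 1 := by push_cast [Nat.cast_sub (by omega : 1 ≤ b)]; ring
  have hx0 : x ≠ [] := by rintro rfl; simp at hx
  have hm : 2 ≤ x.dropLast.length := by simp; omega
  have hm' : ∀ t, 2 ≤ (decAt x t).dropLast.length := fun t => by simp [length_decAt]; omega
  have hm'' : 2 ≤ (x.take (n + 1) ++ [0]).length := by simp; omega
  have h1 : br ((2 - 1) :: (b - 1) :: x.dropLast) = 0 :=
    br_cons_of_lt_two (by norm_num) (by simp; omega)
  rw [tailSum_cons_cons hx0 (n + 1), tailSum_cons hx0 (n + 1)]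
  have hs : ∀ (e f : ℕ → ℚ) (v : ℕ → AnickSpace), (∀ t, e t = - f t) →
      ∑ t ∈ range (n + 1), (b : ℚ) • e t • v t
        = - ∑ t ∈ range (n + 1), f t • (b : ℚ) • v t := by
    intro e f v hef
    rw [← sum_neg_distrib]
    exact sum_congr rfl fun t _ => by rw [hef]; module
  simp only [map_add, map_smul, map_sum, splitFirst_br_cons hm, splitFirst_br_cons (hm' _),
    splitFirst_br_cons hm'', h1, hb1, smul_add, smul_sum, Nat.cast_ofNat, smul_zero,
    add_zero]
  rw [hs _ _ _ fun t => by rw [pow_succ _ (n + 1), mul_neg_one, neg_mul],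
    hs _ (fun t => (-1) ^ (n + 1 + 1) * (ent x (t + 1) - 1)) _ fun t => by
      rw [pow_succ _ (n + 1), mul_neg_one, neg_mul, neg_neg]]
  module

lemma mergeSum_two_one {c : ℕ} {y : List ℕ} (hc : 2 ≤ c) (hy : 2 ≤ y.length) (J : ℕ) :
    mergeSum (2 :: 1 :: c :: y) (J + 2) = 0 := by
  have hc0 : (c : ℚ) ≠ 0 := by positivity
  have hm : ∀ k m, 2 ≤ (mergeAt (c :: y) k m).length := two_le_length_mergeAt (by simpa using hy)
  have hm' : ∀ t k m, 2 ≤ (mergeAt (decAt (c :: y) t) k m).length := fun t =>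
    two_le_length_mergeAt (by simpa [length_decAt] using hy)
  have h : ∀ k, mergeTerm (2 :: 1 :: c :: y) (k + 1) = 0 := fun k => by
    rw [mergeTerm_cons_cons]
    simp [br_cons_cons_of_lt_two one_lt_two (hm _ _), br_cons_cons_of_lt_two one_lt_two (hm' _ _ _),
      br_cons_cons_of_lt_two two_pos (hm _ _)]
  rw [mergeSum_succ, sum_range_succ', mergeTerm_zero]
  simp [h, hc0]
  module

lemma tailSum_two_one {x : List ℕ} (hx : 3 ≤ x.length) (n : ℕ) :
    tailSum (2 :: 1 :: x) (n + 4) = 0 := by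
  have hx0 : x ≠ [] := by rintro rfl; simp at hx
  have hm : 2 ≤ x.dropLast.length := by simp; omega
  have hm' : ∀ t, 2 ≤ (decAt x t).dropLast.length := fun t => by simp [length_decAt]; omega
  have hm'' : 2 ≤ (x.take (n + 1) ++ [0]).length := by simp; omega
  rw [tailSum_cons_cons hx0 (n + 1)]
  simp [br_cons_cons_of_lt_two one_lt_two hm, br_cons_cons_of_lt_two one_lt_two (hm' _),
    br_cons_cons_of_lt_two one_lt_two hm'', br_cons_cons_of_lt_two two_pos hm]

lemma br_mem_A (l : List ℕ) : br l ∈ A l.length := by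
  by_cases h : AnickChain l
  · rw [br, dif_pos h]
    exact Finsupp.single_mem_supported ℚ 1 rfl
  · rw [br_of_not_anickChain h]
    exact zero_mem _

lemma splitFirst_mem_A {n : ℕ} (hn : 4 ≤ n) {u : AnickSpace} (hu : u ∈ A n) :
    splitFirst u ∈ A (n + 1) := by
  rw [A, Finsupp.supported_eq_span_single] at hu
  induction hu using Submodule.span_induction with
  | mem _ h =>
    obtain ⟨⟨l, hl⟩, rfl, rfl⟩ := h
    match l with
    | b :: x =>
      simpa [splitFirst] using (A _).smul_mem (b : ℚ) (br_mem_A (2 :: (b - 1) :: x))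
  | zero => simp
  | add x y _ _ hx hy => rw [map_add]; exact add_mem hx hy
  | smul a x _ hx => rw [map_smul]; exact (A _).smul_mem a hx

lemma anickDelta_br {l : List ℕ} (h : AnickChain l) : anickDelta (br l) = deltaFun l := by
  simp [br, h, anickDelta]

lemma anickDelta_splitFirst_add_br {l : List ℕ} (h : AnickChain l) (hl : 4 ≤ l.length) :
    anickDelta (splitFirst (br l)) + splitFirst (anickDelta (br l)) = (-2 : ℚ) • br l := by
  obtain ⟨n, hn⟩ : ∃ n, l.length = n + 4 := ⟨l.length - 4, by omega⟩
  obtain ⟨b, c, y, rfl⟩ : ∃ b c y, l = b :: c :: y := by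
    match l, hl with
    | b :: c :: y, _ => exact ⟨b, c, y, rfl⟩
  simp only [List.length_cons] at hn
  have h1 := (anickChain_cons (by simp; omega)).1 h
  have h2 := (anickChain_cons (by omega)).1 h1.2
  rw [anickDelta_br h, splitFirst_br_cons (by simp; omega), map_smul]
  have hd (h0 : b = 2 → deltaFun (2 :: (b - 1) :: c :: y) = 0) :
      anickDelta (br (2 :: (b - 1) :: c :: y)) = deltaFun (2 :: (b - 1) :: c :: y) := by
    obtain rfl | hb := h1.1.eq_or_lt
    · rw [h0 rfl, br_cons_cons_of_lt_two (by norm_num) (by simp; omega), map_zero]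
    · refine anickDelta_br ((anickChain_cons (by simp)).2 ⟨le_rfl, ?_⟩)
      exact (anickChain_cons (by simp; omega)).2 ⟨by omega, h1.2⟩
  have he : ∀ k, ent (2 :: (b - 1) :: c :: y) (n + 4 + k) = ent (b :: c :: y) (n + 3 + k) :=
    fun k => by
      rw [show n + 4 + k = n + k + 2 + 2 by ring, show n + 3 + k = n + k + 1 + 2 by ring]
      rfl
  have h3 := h.2.2 (by simp)
  simp only [List.length_cons, hn] at h3
  obtain h3 | ⟨h3, h4⟩ : 2 ≤ ent (b :: c :: y) (n + 3) ∨
      ent (b :: c :: y) (n + 3) = 1 ∧ ent (b :: c :: y) (n + 4) = 0 := h3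
  · have hl := deltaFun_of_two_le (n := n + 4) (l := 2 :: (b - 1) :: c :: y) (by simp; omega)
      ((he 0).symm ▸ h3)
    rw [hd, hl, deltaFun_of_two_le (n := n + 3) (by simp; omega) h3]
    · exact splitFirst_mergeSum h1.1 h2.1 (by omega) (n + 2)
    · rintro rfl
      exact hl.trans (mergeSum_two_one h2.1 (by omega) (n + 2))
  · have hl := deltaFun_of_one_zero (n := n + 4) (l := 2 :: (b - 1) :: c :: y) (by simp; omega)
      ((he 0).trans h3) ((he 1).trans h4)
    rw [hd, hl, deltaFun_of_one_zero (n := n + 3) (by simp; omega) h3 h4, smul_add, map_add,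
      add_add_add_comm, splitFirst_tailSum h1.1 (by simp; omega), add_zero]
    · exact splitFirst_mergeSum h1.1 h2.1 (by omega) n
    · rintro rfl
      rw [hl, Nat.add_sub_assoc (by norm_num)]
      simp only [Nat.reduceSub]
      rw [mergeSum_two_one h2.1 (by omega), tailSum_two_one (by simp; omega), add_zero]

lemma anickDelta_splitFirst_add {n : ℕ} (hn : 4 ≤ n) {u : AnickSpace} (hu : u ∈ A n) :
    anickDelta (splitFirst u) + splitFirst (anickDelta u) = (-2 : ℚ) • u := by
  rw [A, Finsupp.supported_eq_span_single] at hu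
  induction hu using Submodule.span_induction with
  | mem _ h =>
    obtain ⟨c, hc, rfl⟩ := h
    have : Finsupp.single c 1 = br c.1 := by simp [br, c.2]
    beta_reduce
    rw [this]
    exact anickDelta_splitFirst_add_br c.2 (hn.trans_eq hc.symm)
  | zero => simp
  | add x y _ _ hx hy => rw [smul_add, ← hx, ← hy]; simp only [map_add]; abel
  | smul a x _ hx => rw [smul_comm, ← hx]; simp only [map_smul, smul_add]

/-- if `n ≥ 4`, `u ∈ A_n` and `δ_n(u) = 0`, then `u = δ_{n+1}(w)` for
some `w ∈ A_{n+1}`: the complex `(A_•, δ_•)` is exact at `A_n` for all `n ≥ 4`. -/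
theorem anick_complex_exact_high_degree (n : ℕ) (hn : 4 ≤ n) :
    ∀ u ∈ A n, anickDelta u = 0 → ∃ w ∈ A (n + 1), anickDelta w = u := by
  intro u hu hδ
  refine ⟨(-1 / 2 : ℚ) • splitFirst u, (A (n + 1)).smul_mem _ (splitFirst_mem_A hn hu), ?_⟩
  have h := anickDelta_splitFirst_add hn hu
  rw [hδ, map_zero, add_zero] at h
  rw [map_smul, h, smul_smul]
  norm_num
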